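/- arXiv:1111.5723 — 4 statements merged into one kernel-verified Lean document; each statement's English description precedes it below -/
import Mathlib

section
/- Let n ≥ 2, and with J, 𝔰𝔬(n,1), A = diag(0,…,0,1,−1) and n(w) (w ∈ ℝ^{n−1}) as in the Iwasawa setup. Let B ∈ M_{n−1}(ℝ) satisfy Bᵀ = −B and let A₀ ∈ 𝔰𝔬(n,1) be the block diagonal matrix with top-left (n−1)×(n−1) block B and all other entries zero. Then the subspace 𝔰_r = ℝ·(A + A₀) + {n(w) : w ∈ ℝ^{n−1}} is a Lie subalgebra of 𝔰𝔬(n,1), and its derived algebra [𝔰_r, 𝔰_r] equals 𝔫 = {n(w) : w ∈ ℝ^{n−1}}. -/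
open Matrix

noncomputable section

/-- The matrix `J = diag(I_{n-1}, [[0,1],[1,0]])` defining the Lorentz form. -/
def Jmat (n : ℕ) : Matrix (Fin (n-1) ⊕ Fin 2) (Fin (n-1) ⊕ Fin 2) ℝ :=
  Matrix.fromBlocks 1 0 0 !![0,1;1,0]

/-- The Lie algebra `so(n,1) = {M : Mᵀ J + J M = 0}` as a set of matrices. -/
def soLor (n : ℕ) : Set (Matrix (Fin (n-1) ⊕ Fin 2) (Fin (n-1) ⊕ Fin 2) ℝ) :=
  {M | Mᵀ * Jmat n + Jmat n * M = 0}

/-- The matrix `A = diag(0, …, 0, 1, −1)`. -/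
def Amat (n : ℕ) : Matrix (Fin (n-1) ⊕ Fin 2) (Fin (n-1) ⊕ Fin 2) ℝ :=
  Matrix.fromBlocks 0 0 0 !![1,0;0,-1]

/-- The block diagonal matrix `A₀` with top-left `(n−1)×(n−1)` block `B` and all
other entries zero. -/
def A0mat (n : ℕ) (B : Matrix (Fin (n-1)) (Fin (n-1)) ℝ) :
    Matrix (Fin (n-1) ⊕ Fin 2) (Fin (n-1) ⊕ Fin 2) ℝ :=
  Matrix.fromBlocks B 0 0 0

/-- The block matrix `n(w) = [[0, 0, w], [−wᵀ, 0, 0], [0, 0, 0]]`. -/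
def nmat (n : ℕ) (w : Fin (n-1) → ℝ) :
    Matrix (Fin (n-1) ⊕ Fin 2) (Fin (n-1) ⊕ Fin 2) ℝ :=
  Matrix.fromBlocks 0 (Matrix.of fun i j => if j = 1 then w i else 0)
    (Matrix.of fun i j => if i = 0 then -(w j) else 0) 0

/-- The set `𝔫 = {n(w) : w ∈ ℝ^{n−1}}`. -/
def Nset (n : ℕ) : Set (Matrix (Fin (n-1) ⊕ Fin 2) (Fin (n-1) ⊕ Fin 2) ℝ) :=
  {M | ∃ w : Fin (n-1) → ℝ, M = nmat n w}

/-- The set `𝔰_r = ℝ·(A + A₀) + 𝔫`. -/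
def Srset (n : ℕ) (B : Matrix (Fin (n-1)) (Fin (n-1)) ℝ) :
    Set (Matrix (Fin (n-1) ⊕ Fin 2) (Fin (n-1) ⊕ Fin 2) ℝ) :=
  {M | ∃ (a : ℝ) (w : Fin (n-1) → ℝ), M = a • (Amat n + A0mat n B) + nmat n w}

/-- `S` is a Lie subalgebra of the set `T` of matrices, under the commutator bracket:
it is contained in `T`, is a linear subspace, and is closed under the commutator. -/
def IsMatLieSubalgebraOf {ι : Type} [Fintype ι] [DecidableEq ι]
    (T S : Set (Matrix ι ι ℝ)) : Prop :=
  S ⊆ T ∧ (0 ∈ S) ∧ (∀ X ∈ S, ∀ Y ∈ S, X + Y ∈ S) ∧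
    (∀ (a : ℝ), ∀ X ∈ S, a • X ∈ S) ∧ (∀ X ∈ S, ∀ Y ∈ S, X * Y - Y * X ∈ S)

lemma nmat_add (n : ℕ) (v w : Fin (n-1) → ℝ) : nmat n (v + w) = nmat n v + nmat n w := by
  simp only [nmat, fromBlocks_add]
  congr 1 <;> ext i j <;> simp [ite_add_ite, add_comm]

lemma nmat_smul (n : ℕ) (a : ℝ) (w : Fin (n-1) → ℝ) : nmat n (a • w) = a • nmat n w := by
  ext (i | i) (j | j) <;> simp [nmat]

lemma nmat_mul_comm (n : ℕ) (v w : Fin (n-1) → ℝ) :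
    nmat n v * nmat n w = nmat n w * nmat n v := by
  simp only [nmat, fromBlocks_multiply]
  congr 1 <;> ext i j <;> simp [Matrix.mul_apply, mul_comm]

lemma Amat_add_A0mat_commutator_nmat (n : ℕ) (B : Matrix (Fin (n-1)) (Fin (n-1)) ℝ)
    (hB : Bᵀ = -B) (w : Fin (n-1) → ℝ) :
    (Amat n + A0mat n B) * nmat n w - nmat n w * (Amat n + A0mat n B) =
      nmat n ((1 + B) *ᵥ w) := by
  have hskew : ∀ i j, B i j = -B j i := fun i j => by
    simpa using congrFun (congrFun hB j) i
  rw [add_mulVec, one_mulVec]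
  ext (i | i) (j | j)
  · simp [nmat, Amat, A0mat, fromBlocks_multiply, fromBlocks_add]
  · fin_cases j <;>
      simp [nmat, Amat, A0mat, fromBlocks_multiply, fromBlocks_add, Matrix.mul_apply,
        mulVec, dotProduct, add_comm]
  · fin_cases i <;>
      simp [nmat, Amat, A0mat, fromBlocks_multiply, fromBlocks_add, Matrix.mul_apply,
        mulVec, dotProduct, hskew j, mul_comm, vecHead, vecTail, add_comm]
  · simp [nmat, Amat, A0mat, fromBlocks_multiply, fromBlocks_add]

lemma commutator_smul_add_nmat (n : ℕ) (B : Matrix (Fin (n-1)) (Fin (n-1)) ℝ)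
    (hB : Bᵀ = -B) (a b : ℝ) (v w : Fin (n-1) → ℝ) :
    (a • (Amat n + A0mat n B) + nmat n v) * (b • (Amat n + A0mat n B) + nmat n w) -
      (b • (Amat n + A0mat n B) + nmat n w) * (a • (Amat n + A0mat n B) + nmat n v) =
      nmat n ((1 + B) *ᵥ (a • w + (-b) • v)) := by
  rw [mulVec_add, mulVec_smul, mulVec_smul, nmat_add, nmat_smul, nmat_smul,
    ← Amat_add_A0mat_commutator_nmat n B hB v, ← Amat_add_A0mat_commutator_nmat n B hB w]
  generalize Amat n + A0mat n B = D
  simp only [add_mul, mul_add, smul_mul_assoc, mul_smul_comm, nmat_mul_comm n v w]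
  module

/-- If `B` is real and skew-symmetric then `1 + B` is onto. -/
lemma one_add_mulVec_surjective_of_transpose_eq_neg {ι : Type*} [Fintype ι] [DecidableEq ι]
    (B : Matrix ι ι ℝ) (hB : Bᵀ = -B) : Function.Surjective ((1 + B) *ᵥ ·) := by
  have hinj : Function.Injective (1 + B).mulVecLin := by
    rw [injective_iff_map_eq_zero]
    intro v hv
    have hskew : v ⬝ᵥ B *ᵥ v = 0 := by
      have h : v ⬝ᵥ B *ᵥ v = -(v ⬝ᵥ B *ᵥ v) := by
        conv_lhs => rw [dotProduct_comm, ← vecMul_transpose, ← dotProduct_mulVec, hB]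
        rw [neg_mulVec, dotProduct_neg]
      linarith
    have h : v ⬝ᵥ (1 + B) *ᵥ v = 0 := by
      rw [← mulVecLin_apply, hv, dotProduct_zero]
    rw [add_mulVec, one_mulVec, dotProduct_add, hskew, add_zero] at h
    exact dotProduct_self_eq_zero.mp h
  exact LinearMap.injective_iff_surjective.mp hinj

lemma nmat_mem_soLor (n : ℕ) (w : Fin (n-1) → ℝ) : nmat n w ∈ soLor n := by
  ext (i | i) (j | j)
  · simp [nmat, Jmat, fromBlocks_transpose, fromBlocks_multiply]
  · fin_cases j <;>
      simp [nmat, Jmat, fromBlocks_transpose, fromBlocks_multiply, Matrix.mul_apply]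
  · fin_cases i <;>
      simp [nmat, Jmat, fromBlocks_transpose, fromBlocks_multiply, vecHead, vecTail]
  · simp [nmat, Jmat, fromBlocks_transpose, fromBlocks_multiply]

lemma Amat_add_A0mat_mem_soLor (n : ℕ) (B : Matrix (Fin (n-1)) (Fin (n-1)) ℝ)
    (hB : Bᵀ = -B) : Amat n + A0mat n B ∈ soLor n := by
  ext (i | i) (j | j)
  · simp [Amat, A0mat, Jmat, fromBlocks_transpose, fromBlocks_multiply, fromBlocks_add, hB]
  · simp [Amat, A0mat, Jmat, fromBlocks_transpose, fromBlocks_multiply, fromBlocks_add]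
  · simp [Amat, A0mat, Jmat, fromBlocks_transpose, fromBlocks_multiply, fromBlocks_add]
  · fin_cases i <;> fin_cases j <;>
      simp [Amat, A0mat, Jmat, fromBlocks_transpose, fromBlocks_multiply, fromBlocks_add,
        Matrix.mul_apply]

lemma smul_add_mem_soLor (n : ℕ) (a : ℝ)
    {M N : Matrix (Fin (n-1) ⊕ Fin 2) (Fin (n-1) ⊕ Fin 2) ℝ}
    (hM : M ∈ soLor n) (hN : N ∈ soLor n) : a • M + N ∈ soLor n := by
  simp only [soLor, Set.mem_ofPred_eq] at *
  calc (a • M + N)ᵀ * Jmat n + Jmat n * (a • M + N)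
      = a • (Mᵀ * Jmat n + Jmat n * M) + (Nᵀ * Jmat n + Jmat n * N) := by
        simp only [transpose_add, transpose_smul, add_mul, mul_add, smul_mul_assoc,
          mul_smul_comm]
        module
    _ = 0 := by rw [hM, hN, smul_zero, add_zero]

/-- For `B` skew-symmetric, `𝔰_r = ℝ·(A + A₀) + 𝔫` is a Lie subalgebra of `so(n,1)`
and its derived algebra `[𝔰_r, 𝔰_r]` equals `𝔫`. -/
theorem sr_subalgebra_derived_eq_n (n : ℕ) (hn : 2 ≤ n)
    (B : Matrix (Fin (n-1)) (Fin (n-1)) ℝ) (hB : Bᵀ = -B) :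
    IsMatLieSubalgebraOf (soLor n) (Srset n B) ∧
    (Submodule.span ℝ
        {M : Matrix (Fin (n-1) ⊕ Fin 2) (Fin (n-1) ⊕ Fin 2) ℝ |
          ∃ X ∈ Srset n B, ∃ Y ∈ Srset n B, M = X * Y - Y * X} : Set _) = Nset n := by
  have nmat_zero : nmat n 0 = 0 := by simpa using nmat_smul n 0 0
  refine ⟨⟨?_, ⟨0, 0, by simp [nmat_zero]⟩, ?_, ?_, ?_⟩, Set.Subset.antisymm ?_ ?_⟩
  · rintro _ ⟨a, w, rfl⟩
    exact smul_add_mem_soLor n a (Amat_add_A0mat_mem_soLor n B hB) (nmat_mem_soLor n w)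
  · rintro _ ⟨a, v, rfl⟩ _ ⟨b, w, rfl⟩
    exact ⟨a + b, v + w, by rw [nmat_add]; module⟩
  · rintro c _ ⟨a, w, rfl⟩
    exact ⟨c * a, c • w, by rw [nmat_smul]; module⟩
  · rintro _ ⟨a, v, rfl⟩ _ ⟨b, w, rfl⟩
    exact ⟨0, _, by rw [commutator_smul_add_nmat n B hB, zero_smul, zero_add]⟩
  · intro M hM
    induction hM using Submodule.span_induction with
    | mem M h =>
      obtain ⟨_, ⟨a, v, rfl⟩, _, ⟨b, w, rfl⟩, rfl⟩ := h
      exact ⟨_, commutator_smul_add_nmat n B hB a b v w⟩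
    | zero => exact ⟨0, nmat_zero.symm⟩
    | add _ _ _ _ h₁ h₂ =>
      obtain ⟨v, rfl⟩ := h₁
      obtain ⟨w, rfl⟩ := h₂
      exact ⟨v + w, (nmat_add n v w).symm⟩
    | smul c _ _ h =>
      obtain ⟨w, rfl⟩ := h
      exact ⟨c • w, (nmat_smul n c w).symm⟩
  · rintro _ ⟨u, rfl⟩
    obtain ⟨w, rfl⟩ := one_add_mulVec_surjective_of_transpose_eq_neg B hB u
    refine Submodule.subset_span ⟨_, ⟨1, 0, rfl⟩, _, ⟨0, w, rfl⟩, ?_⟩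
    rw [commutator_smul_add_nmat n B hB]
    simp
end
end

section
/- Let 𝔞 be an abelian Lie subalgebra of 𝔰𝔬(m,ℝ), the Lie algebra of real skew-symmetric m×m matrices. Then 2·dim_ℝ 𝔞 ≤ m. -/
open Matrix

theorem Submodule.span_eq_top_of_forall_apply_eq_zero {K V : Type*} [Field K] [AddCommGroup V]
    [Module K V] [FiniteDimensional K V] (S : Set (Module.Dual K V))
    (hS : ∀ x, (∀ φ ∈ S, φ x = 0) → x = 0) : Submodule.span K S = ⊤ := by
  rw [← Subspace.dualCoannihilator_dualAnnihilator_eq (W := Submodule.span K S),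
    Submodule.dualAnnihilator_eq_top_iff, eq_bot_iff]
  intro x hx
  rw [Submodule.mem_dualCoannihilator] at hx
  exact hS x fun φ hφ => hx φ (Submodule.subset_span hφ)

/-- A set of functionals that is stable under negation and separates points contains a basis of the
dual together with its negatives. -/
theorem exists_injective_sum_of_separating {V : Type*} [AddCommGroup V] [Module ℝ V]
    [FiniteDimensional ℝ V] (S : Set (Module.Dual ℝ V)) (hneg : ∀ φ ∈ S, -φ ∈ S)
    (hS : ∀ x, (∀ φ ∈ S, φ x = 0) → x = 0) :
    ∃ f : Fin (Module.finrank ℝ V) ⊕ Fin (Module.finrank ℝ V) → S, Function.Injective f := by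
  obtain ⟨b, hbS, hspan, hli⟩ := exists_linearIndependent ℝ S
  rw [Submodule.span_eq_top_of_forall_apply_eq_zero S hS] at hspan
  let B : Module.Basis b ℝ (Module.Dual ℝ V) := .mk hli (by simp [hspan])
  have : Finite b := hli.finite
  have : Fintype b := Fintype.ofFinite b
  have hcard : Fintype.card b = Module.finrank ℝ V := by
    rw [← Module.finrank_eq_card_basis B, Subspace.dual_finrank_eq]
  let e := (Fintype.equivFinOfCardEq hcard).symm
  have hne (x y : b) : (x : Module.Dual ℝ V) ≠ -(y : Module.Dual ℝ V) := by
    intro h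
    have hB (z : b) : B z = z := Module.Basis.mk_apply ..
    have := congrArg (fun φ => B.repr φ x) h
    simp only [map_neg, Finsupp.neg_apply, ← hB, Module.Basis.repr_self,
      Finsupp.single_eq_same] at this
    rcases eq_or_ne x y with rfl | hxy
    · norm_num at this
    · norm_num [Finsupp.single_eq_of_ne hxy] at this
  refine ⟨Sum.elim (fun i => ⟨e i, hbS (e i).2⟩) (fun i => ⟨-(e i), hneg _ (hbS (e i).2)⟩), ?_⟩
  refine Function.Injective.sumElim ?_ ?_ ?_
  · intro i j h
    exact e.injective (Subtype.ext (by simpa using h))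
  · intro i j h
    exact e.injective (Subtype.ext (by simpa using h))
  · intro i j h
    exact hne _ _ (congrArg Subtype.val h)

namespace Matrix

variable {n : Type*} [Fintype n] [DecidableEq n]

/-- The endomorphism `i A` of `ℂⁿ` attached to a real matrix `A`. -/
noncomputable def complexRotation (A : Matrix n n ℝ) : Module.End ℂ (EuclideanSpace ℂ n) :=
  toEuclideanLin (Complex.I • A.map Complex.ofReal)

theorem complexRotation_apply (A : Matrix n n ℝ) (v : EuclideanSpace ℂ n) (i : n) :
    complexRotation A v i = Complex.I * ∑ j, (A i j : ℂ) * v j := by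
  simp [complexRotation, toLpLin_apply, mulVec, dotProduct]

theorem complexRotation_add (A B : Matrix n n ℝ) :
    complexRotation (A + B) = complexRotation A + complexRotation B := by
  ext v i
  simp [complexRotation_apply, add_mul, mul_add, Finset.sum_add_distrib]

theorem complexRotation_smul (c : ℝ) (A : Matrix n n ℝ) :
    complexRotation (c • A) = (c : ℂ) • complexRotation A := by
  ext v i
  simp [complexRotation_apply, Finset.mul_sum, mul_assoc, mul_left_comm]

theorem complexRotation_injective : Function.Injective (complexRotation (n := n)) := by
  intro A B h
  have h' := toEuclideanLin.injective h
  ext i j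
  simpa using congrFun (congrFun h' i) j

theorem complexRotation_isSymmetric {A : Matrix n n ℝ} (hA : Aᵀ = -A) :
    (complexRotation A).IsSymmetric := by
  rw [complexRotation, isSymmetric_toEuclideanLin_iff]
  ext i j
  have := congrFun (congrFun hA i) j
  simp only [transpose_apply, neg_apply] at this
  simp [this]

theorem complexRotation_commute {A B : Matrix n n ℝ} (h : A * B - B * A = 0) :
    Commute (complexRotation A) (complexRotation B) := by
  have h' : A.map Complex.ofReal * B.map Complex.ofReal =
      B.map Complex.ofReal * A.map Complex.ofReal := by
    have := congrArg (fun M => M.map Complex.ofRealHom) (sub_eq_zero.mp h)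
    rwa [Matrix.map_mul, Matrix.map_mul] at this
  rw [commute_iff_eq, complexRotation, complexRotation, Module.End.mul_eq_comp,
    Module.End.mul_eq_comp, ← toLpLin_mul, ← toLpLin_mul]
  simp [h']

/-- The common eigenspace of the operators `i A`, `A ∈ 𝔞`, with eigenvalues `χ A`. -/
noncomputable abbrev weightSpace (𝔞 : Submodule ℝ (Matrix n n ℝ)) (χ : 𝔞 → ℂ) :
    Submodule ℂ (EuclideanSpace ℂ n) :=
  ⨅ A : 𝔞, (complexRotation (A : Matrix n n ℝ)).eigenspace (χ A)

theorem mem_weightSpace {𝔞 : Submodule ℝ (Matrix n n ℝ)} {χ : 𝔞 → ℂ} {v : EuclideanSpace ℂ n} :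
    v ∈ weightSpace 𝔞 χ ↔ ∀ A : 𝔞, complexRotation (A : Matrix n n ℝ) v = χ A • v := by
  simp [weightSpace, Submodule.mem_iInf]

theorem weightSpace_neg_ne_bot {𝔞 : Submodule ℝ (Matrix n n ℝ)} {φ : Module.Dual ℝ 𝔞}
    (h : weightSpace 𝔞 (fun A => (φ A : ℂ)) ≠ ⊥) :
    weightSpace 𝔞 (fun A => ((-φ) A : ℂ)) ≠ ⊥ := by
  obtain ⟨v, hv, hv0⟩ := Submodule.exists_mem_ne_zero_of_ne_bot h
  rw [mem_weightSpace] at hv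
  refine (Submodule.ne_bot_iff _).mpr ⟨WithLp.toLp 2 (star v.ofLp), mem_weightSpace.mpr ?_, ?_⟩
  · intro A
    ext i
    have := congrArg (starRingEnd ℂ) (congrArg (fun w => w.ofLp i) (hv A))
    simp only [complexRotation_apply, PiLp.smul_apply, smul_eq_mul, map_mul, map_sum,
      Complex.conj_I, Complex.conj_ofReal] at this
    simp only [complexRotation_apply, PiLp.smul_apply, smul_eq_mul, LinearMap.neg_apply,
      Complex.ofReal_neg, Pi.star_apply, RCLike.star_def]
    linear_combination -this
  · intro h0
    apply hv0
    ext i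
    simpa using congrArg (fun w => w.ofLp i) h0

theorem exists_dual_of_weightSpace_ne_bot {𝔞 : Submodule ℝ (Matrix n n ℝ)}
    (hskew : ∀ A ∈ 𝔞, Aᵀ = -A) {χ : 𝔞 → ℂ} (h : weightSpace 𝔞 χ ≠ ⊥) :
    ∃ φ : Module.Dual ℝ 𝔞, (fun A => (φ A : ℂ)) = χ := by
  obtain ⟨v, hv, hv0⟩ := Submodule.exists_mem_ne_zero_of_ne_bot h
  rw [mem_weightSpace] at hv
  have hreal (A : 𝔞) : ((χ A).re : ℂ) = χ A :=
    Complex.conj_eq_iff_re.mp <| (complexRotation_isSymmetric (hskew A A.2)).conj_eigenvalue_eq_self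
      (Module.End.hasEigenvalue_of_hasEigenvector
        ⟨Module.End.mem_eigenspace_iff.mpr (hv A), hv0⟩)
  have hadd (A B : 𝔞) : χ (A + B) = χ A + χ B := by
    apply smul_left_injective ℂ hv0
    simp [← hv, complexRotation_add, add_smul]
  have hsmul (c : ℝ) (A : 𝔞) : χ (c • A) = c * χ A := by
    apply smul_left_injective ℂ hv0
    simp [← hv, complexRotation_smul, mul_smul]
  exact ⟨{ toFun := fun A => (χ A).re
           map_add' := fun A B => by simp [hadd]
           map_smul' := fun c A => by simp [hsmul] }, funext hreal⟩

end Matrix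

/-- An abelian Lie subalgebra `𝔞` of the real skew-symmetric `m × m` matrices
satisfies `2 · dim 𝔞 ≤ m`. -/
theorem abelian_subalgebra_of_so_dim_le
    (m : ℕ) (𝔞 : Submodule ℝ (Matrix (Fin m) (Fin m) ℝ))
    (hskew : ∀ A ∈ 𝔞, Aᵀ = -A)
    (habelian : ∀ A ∈ 𝔞, ∀ B ∈ 𝔞, A * B - B * A = 0) :
    2 * Module.finrank ℝ 𝔞 ≤ m := by
  have hsymm (A : 𝔞) := complexRotation_isSymmetric (hskew A A.2)
  have htop : ⨆ χ, weightSpace 𝔞 χ = ⊤ :=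
    LinearMap.IsSymmetric.iSup_iInf_eq_top_of_commute hsymm
      fun A B _ => complexRotation_commute (habelian A A.2 B B.2)
  have hindep : iSupIndep (weightSpace 𝔞) :=
    (LinearMap.IsSymmetric.orthogonalFamily_iInf_eigenspaces hsymm).independent
  let S : Set (Module.Dual ℝ 𝔞) := {φ | weightSpace 𝔞 (fun A => (φ A : ℂ)) ≠ ⊥}
  have hsep (A : 𝔞) (hA : ∀ φ ∈ S, φ A = 0) : A = 0 := by
    have hker : LinearMap.ker (complexRotation (A : Matrix (Fin m) (Fin m) ℝ)) = ⊤ := by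
      rw [eq_top_iff, ← htop]
      refine iSup_le fun χ => ?_
      by_cases hχ : weightSpace 𝔞 χ = ⊥
      · simp [hχ]
      · obtain ⟨φ, rfl⟩ := exists_dual_of_weightSpace_ne_bot hskew hχ
        intro v hv
        simpa [hA φ hχ] using mem_weightSpace.mp hv A
    apply Subtype.ext
    apply complexRotation_injective
    rw [LinearMap.ker_eq_top.mp hker]
    simpa using (complexRotation_smul 0 (0 : Matrix (Fin m) (Fin m) ℝ)).symm
  obtain ⟨f, hf⟩ := exists_injective_sum_of_separating S (fun _ => weightSpace_neg_ne_bot) hsep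
  choose v hv hv0 using fun i => Submodule.exists_mem_ne_zero_of_ne_bot (f i).2
  have hinj : Function.Injective fun i => fun A => ((f i : Module.Dual ℝ 𝔞) A : ℂ) := by
    intro i j hij
    refine hf (Subtype.ext (LinearMap.ext fun A => ?_))
    exact Complex.ofReal_injective (congrFun hij A)
  have := ((hindep.comp hinj).linearIndependent _ hv hv0).fintype_card_le_finrank
  simpa [two_mul] using this
end

section
/- Let 𝔤 be a real Lie algebra, 𝔥 ⊆ 𝔤 a Lie subalgebra, 𝔫 ⊆ 𝔤 a subspace, A, A₀ ∈ 𝔤, and φ : 𝔫 → 𝔥 a linear map, satisfying: (i) [X,Y] = 0 for all X,Y ∈ 𝔫; (ii) [H,X] ∈ 𝔫 for all H ∈ 𝔥, X ∈ 𝔫; (iii) φ([H,X]) = [H,φ(X)] for all H ∈ 𝔥, X ∈ 𝔫; (iv) [A,X] = X for all X ∈ 𝔫; (v) [A,H] = 0 and [A₀,H] = 0 for all H ∈ 𝔥; (vi) [A₀,X] ∈ 𝔫 for all X ∈ 𝔫; (vii) the map X ↦ X + [A₀,X] is a surjection of 𝔫 onto 𝔫. Set ξ = A + A₀ and 𝔪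 = ℝ·ξ + {X + φ(X) : X ∈ 𝔫}, and assume 𝔤 is the internal direct sum of the subspaces 𝔥 and 𝔪; let P : 𝔤 → 𝔥 denote the projection onto 𝔥 along 𝔪. Then the Lie subalgebra of 𝔥 generated by the set {P([B,C]) : B, C ∈ 𝔪} is exactly the image φ(𝔫). In particular φ(𝔫) is a Lie subalgebra (indeed an ideal) of 𝔥. -/
theorem Submodule.eq_of_isCompl_of_sub_mem {R M : Type*} [Ring R] [AddCommGroup M] [Module R M]
    {p q : Submodule R M} (hpq : IsCompl p q) {x y z : M} (hy : y ∈ p) (hz : z ∈ p)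
    (hxy : x - y ∈ q) (hxz : x - z ∈ q) : y = z := by
  refine sub_eq_zero.mp (Submodule.disjoint_def.mp hpq.disjoint _ (p.sub_mem hy hz) ?_)
  simpa using q.sub_mem hxz hxy

/-- The holonomy algebra of the canonical connection of the reductive decomposition
`𝔤 = 𝔥 + 𝔪`, where `𝔪 = ℝ·(A + A₀) + graph(φ)`, is exactly `φ(𝔫)`: the Lie
subalgebra generated by the `𝔥`-components `P[B,C]`, `B, C ∈ 𝔪`, equals `φ(𝔫)`,
and `φ(𝔫)` is an ideal of `𝔥`. -/
theorem holonomy_algebra_eq_phi_of_n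
    (𝔤 : Type) [LieRing 𝔤] [LieAlgebra ℝ 𝔤]
    (𝔥 : LieSubalgebra ℝ 𝔤) (𝔫 : Submodule ℝ 𝔤) (A A₀ : 𝔤)
    (φ : 𝔤 →ₗ[ℝ] 𝔤)
    (h_ab : ∀ X ∈ 𝔫, ∀ Y ∈ 𝔫, ⁅X, Y⁆ = 0)
    (h_stab : ∀ H ∈ 𝔥, ∀ X ∈ 𝔫, ⁅H, X⁆ ∈ 𝔫)
    (hφ_range : ∀ X ∈ 𝔫, φ X ∈ 𝔥)
    (hφ_equiv : ∀ H ∈ 𝔥, ∀ X ∈ 𝔫, φ ⁅H, X⁆ = ⁅H, φ X⁆)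
    (hA : ∀ X ∈ 𝔫, ⁅A, X⁆ = X)
    (hA_h : ∀ H ∈ 𝔥, ⁅A, H⁆ = 0)
    (hA₀_h : ∀ H ∈ 𝔥, ⁅A₀, H⁆ = 0)
    (hA₀_n : ∀ X ∈ 𝔫, ⁅A₀, X⁆ ∈ 𝔫)
    (hA₀_surj : ∀ Y ∈ 𝔫, ∃ X ∈ 𝔫, X + ⁅A₀, X⁆ = Y)
    (𝔪 : Submodule ℝ 𝔤)
    (h𝔪 : 𝔪 = Submodule.span ℝ {A + A₀} ⊔ Submodule.map (LinearMap.id + φ) 𝔫)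
    (hcompl : IsCompl 𝔥.toSubmodule 𝔪)
    (P : 𝔤 →ₗ[ℝ] 𝔤)
    (hP : ∀ x : 𝔤, P x ∈ 𝔥 ∧ x - P x ∈ 𝔪) :
    ((LieSubalgebra.lieSpan ℝ 𝔤
        {h : 𝔤 | ∃ B ∈ 𝔪, ∃ C ∈ 𝔪, h = P ⁅B, C⁆} : LieSubalgebra ℝ 𝔤) : Set 𝔤)
        = φ '' (𝔫 : Set 𝔤) ∧
      ∀ H ∈ 𝔥, ∀ Z ∈ φ '' (𝔫 : Set 𝔤), ⁅H, Z⁆ ∈ φ '' (𝔫 : Set 𝔤) := by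
  have hgraph : ∀ X ∈ 𝔫, X + φ X ∈ 𝔪 := fun X hX => by
    rw [h𝔪]
    exact Submodule.mem_sup_right ⟨X, hX, by simp⟩
  have hξ : A + A₀ ∈ 𝔪 := by
    rw [h𝔪]
    exact Submodule.mem_sup_left (Submodule.mem_span_singleton_self _)
  have hP_add : ∀ W ∈ 𝔫, ∀ H ∈ 𝔥, P (W + H) = H - φ W := fun W hW H hH => by
    refine Submodule.eq_of_isCompl_of_sub_mem hcompl (hP _).1
      (𝔥.toSubmodule.sub_mem hH (hφ_range W hW)) (hP (W + H)).2 ?_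
    convert hgraph W hW using 1
    abel
  have hξ_bracket : ∀ X ∈ 𝔫, ⁅A + A₀, X + φ X⁆ = X + ⁅A₀, X⁆ := fun X hX => by
    rw [lie_add, add_lie, add_lie, hA X hX, hA_h _ (hφ_range X hX), hA₀_h _ (hφ_range X hX)]
    simp
  have hP_ξ : ∀ X ∈ 𝔫, P ⁅A + A₀, X + φ X⁆ = -φ (X + ⁅A₀, X⁆) := fun X hX => by
    rw [hξ_bracket X hX]
    simpa using hP_add _ (𝔫.add_mem hX (hA₀_n X hX)) 0 𝔥.zero_mem
  have hP_graph : ∀ X ∈ 𝔫, ∀ Y ∈ 𝔫, P ⁅X + φ X, Y + φ Y⁆ = φ ⁅φ Y, X⁆ := fun X hX Y hY => by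
    have hX' := hφ_range X hX
    have hY' := hφ_range Y hY
    have key : ⁅X + φ X, Y + φ Y⁆ = (⁅φ X, Y⁆ - ⁅φ Y, X⁆) + ⁅φ X, φ Y⁆ := by
      rw [lie_add, add_lie, add_lie, h_ab X hX Y hY, ← lie_skew X (φ Y)]
      abel
    rw [key, hP_add _ (𝔫.sub_mem (h_stab _ hX' Y hY) (h_stab _ hY' X hX)) _
      (𝔥.lie_mem hX' hY'), map_sub, hφ_equiv _ hX' Y hY]
    abel
  have hideal : ∀ H ∈ 𝔥, ∀ Z ∈ φ '' (𝔫 : Set 𝔤), ⁅H, Z⁆ ∈ φ '' (𝔫 : Set 𝔤) := by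
    rintro H hH _ ⟨X, hX, rfl⟩
    exact ⟨⁅H, X⁆, h_stab H hH X hX, hφ_equiv H hH X hX⟩
  refine ⟨Set.Subset.antisymm ?_ ?_, hideal⟩
  · let K : LieSubalgebra ℝ 𝔤 :=
      { 𝔫.map φ with
        lie_mem' := by
          rintro _ Z ⟨X, hX, rfl⟩ hZ
          exact hideal _ (hφ_range X hX) Z hZ }
    suffices h : LieSubalgebra.lieSpan ℝ 𝔤 {h : 𝔤 | ∃ B ∈ 𝔪, ∃ C ∈ 𝔪, h = P ⁅B, C⁆} ≤ K from h
    rw [LieSubalgebra.lieSpan_le]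
    rintro _ ⟨B, hB, C, hC, rfl⟩
    have hdecomp : ∀ D ∈ 𝔪, ∃ c : ℝ, ∃ X ∈ 𝔫, D = c • (A + A₀) + (X + φ X) := fun D hD => by
      rw [h𝔪] at hD
      obtain ⟨_, hu, _, ⟨X, hX, rfl⟩, rfl⟩ := Submodule.mem_sup.mp hD
      obtain ⟨c, rfl⟩ := Submodule.mem_span_singleton.mp hu
      exact ⟨c, X, hX, by simp⟩
    obtain ⟨b, X, hX, rfl⟩ := hdecomp B hB
    obtain ⟨c, Y, hY, rfl⟩ := hdecomp C hC
    have key : ⁅b • (A + A₀) + (X + φ X), c • (A + A₀) + (Y + φ Y)⁆ =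
        b • ⁅A + A₀, Y + φ Y⁆ - c • ⁅A + A₀, X + φ X⁆ + ⁅X + φ X, Y + φ Y⁆ := by
      generalize A + A₀ = ξ
      generalize X + φ X = U
      generalize Y + φ Y = V
      rw [lie_add, add_lie, add_lie, smul_lie, smul_lie, lie_smul, lie_smul, lie_self,
        ← lie_skew U ξ]
      simp only [smul_zero, smul_neg]
      abel
    refine ⟨-(b • (Y + ⁅A₀, Y⁆)) + c • (X + ⁅A₀, X⁆) + ⁅φ Y, X⁆, ?_, ?_⟩
    · exact 𝔫.add_mem (𝔫.add_mem (𝔫.neg_mem (𝔫.smul_mem _ (𝔫.add_mem hY (hA₀_n Y hY))))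
        (𝔫.smul_mem _ (𝔫.add_mem hX (hA₀_n X hX)))) (h_stab _ (hφ_range Y hY) X hX)
    · rw [key, map_add P, map_sub P, map_smul P, map_smul P, hP_ξ X hX, hP_ξ Y hY,
        hP_graph X hX Y hY, map_add φ, map_add φ, map_neg φ, map_smul φ, map_smul φ]
      simp only [smul_neg]
      abel
  · rintro _ ⟨Y, hY, rfl⟩
    obtain ⟨X, hX, rfl⟩ := hA₀_surj Y hY
    rw [← neg_neg (φ _), ← hP_ξ X hX]
    exact neg_mem (LieSubalgebra.subset_lieSpan ⟨_, hξ, _, hgraph X hX, rfl⟩)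
end

section
/- Let n ≥ 1 with n ≠ 3. Then every linear map L : ℝⁿ → M_n(ℝ) such that L(v) is skew-symmetric for every v ∈ ℝⁿ (L(v)ᵀ = −L(v)) and L(g·v) = g·L(v)·gᵀ for every g ∈ SO(n) (real n×n matrix with gᵀg = 1 and det g = 1) and every v ∈ ℝⁿ, is identically zero. -/
open Matrix

/-- Equivariance under a diagonal sign matrix of determinant one. -/
theorem sign_mul_entry_eq_of_equivariant {n : ℕ}
    (L : (Fin n → ℝ) →ₗ[ℝ] Matrix (Fin n) (Fin n) ℝ)
    (hequiv : ∀ g : Matrix (Fin n) (Fin n) ℝ, gᵀ * g = 1 → g.det = 1 →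
      ∀ v : Fin n → ℝ, L (g *ᵥ v) = g * L v * gᵀ)
    (d : Fin n → ℝ) (hd : ∀ x, d x * d x = 1) (hprod : ∏ x, d x = 1) (i j k : Fin n) :
    d i * L (Pi.single i 1) j k = d j * L (Pi.single i 1) j k * d k := by
  have h := hequiv (diagonal d)
    (by rw [diagonal_transpose, diagonal_mul_diagonal, ← diagonal_one]; simp [hd])
    (by rw [det_diagonal, hprod]) (Pi.single i 1)
  have hv : diagonal d *ᵥ Pi.single i 1 = d i • (Pi.single i 1 : Fin n → ℝ) := by
    ext x
    rw [mulVec_diagonal]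
    rcases eq_or_ne x i with rfl | hx <;> simp [*]
  rw [hv, map_smul, diagonal_transpose] at h
  simpa [diagonal_mul, mul_diagonal] using congrFun (congrFun h j) k

/-- The sign vector flipping two coordinates. -/
theorem entry_eq_of_flip_two {n : ℕ}
    (L : (Fin n → ℝ) →ₗ[ℝ] Matrix (Fin n) (Fin n) ℝ)
    (hequiv : ∀ g : Matrix (Fin n) (Fin n) ℝ, gᵀ * g = 1 → g.det = 1 →
      ∀ v : Fin n → ℝ, L (g *ᵥ v) = g * L v * gᵀ)
    (a b i j k : Fin n) (hi : i ≠ b) (hj : j ≠ b) (hk : k ≠ b) :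
    (if i = a then -1 else 1) * L (Pi.single i 1) j k =
      (if j = a then -1 else 1) * L (Pi.single i 1) j k * (if k = a then -1 else 1) := by
  have h := sign_mul_entry_eq_of_equivariant L hequiv
    (fun x => (if x = a then -1 else 1) * (if x = b then -1 else 1))
    (fun x => by split_ifs <;> norm_num)
    (by rw [Finset.prod_mul_distrib]; simp) i j k
  simpa [hi, hj, hk] using h

/-- For `n ≥ 1`, `n ≠ 3`, every `SO(n)`-equivariant linear map from `ℝⁿ` to the
skew-symmetric `n × n` matrices is zero. -/
theorem equivariant_skew_map_eq_zero_of_ne_three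
    (n : ℕ) (hn : 1 ≤ n) (hn3 : n ≠ 3)
    (L : (Fin n → ℝ) →ₗ[ℝ] Matrix (Fin n) (Fin n) ℝ)
    (hskew : ∀ v : Fin n → ℝ, (L v)ᵀ = -(L v))
    (hequiv : ∀ g : Matrix (Fin n) (Fin n) ℝ, gᵀ * g = 1 → g.det = 1 →
      ∀ v : Fin n → ℝ, L (g *ᵥ v) = g * L v * gᵀ) :
    L = 0 := by
  have key : ∀ i j k : Fin n, L (Pi.single i 1) j k = 0 := by
    intro i j k
    rcases eq_or_ne j k with rfl | hjk
    · have h := congrFun (congrFun (hskew (Pi.single i 1)) j) j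
      simp only [transpose_apply, Matrix.neg_apply] at h
      linarith
    rcases Nat.lt_or_ge n 4 with hlt | hge
    · obtain rfl | rfl : n = 1 ∨ n = 2 := by omega
      · exact absurd (Subsingleton.elim j k) hjk
      · have h := sign_mul_entry_eq_of_equivariant L hequiv (fun _ => -1)
          (by norm_num) (by norm_num) i j k
        linarith
    · obtain ⟨b, hb⟩ : ∃ b, b ∉ ({i, j, k} : Finset (Fin n)) := by
        by_contra! hall
        have hcard := Finset.card_le_card (fun x _ => hall x : Finset.univ ⊆ {i, j, k})
        rw [Finset.card_univ, Fintype.card_fin] at hcard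
        have := Finset.card_le_three (a := i) (b := j) (c := k)
        omega
      simp only [Finset.mem_insert, Finset.mem_singleton, not_or] at hb
      have flip := fun a => entry_eq_of_flip_two L hequiv a b i j k
        (Ne.symm hb.1) (Ne.symm hb.2.1) (Ne.symm hb.2.2)
      have hkj := hjk.symm
      rcases eq_or_ne i j with rfl | hij
      · have h := flip k
        simp only [hjk, if_true, if_false] at h
        linarith
      · have h := flip j
        simp only [hij, hkj, if_true, if_false] at h
        linarith
  refine LinearMap.pi_ext' fun i => LinearMap.ext_ring ?_
  ext j k
  simpa using key i j k
end
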